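/- arXiv:1412.1130 — 8 statements merged into one kernel-verified Lean document; each statement's English description precedes it below -/
import Mathlib

section
/- Consider a 3GSM instance of size n = 2 with A = {a1, a2}, B = {b1, b2}, D = {d1, d2} whose preferences satisfy: (b1,d1) is a1's most preferred pair and (b2,d2) her second most preferred pair; (b2,d1) is a2's most preferred pair; (a1,d1) is b1's most preferred pair; (a1,d2) is b2's most preferred pair and (a2,d1) his second most preferred pair; (a2,b2) is d1's most preferred pair and (a1,b1) its second most preferred pair; (a1,b2) is d2's most preferred pair (all remaining preferences arbitrary). Then every marriage contains at least one unstable triple; in particular, this instance admits no stable marriage. -/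
open Classical

/-- A 3GSM instance of size `n`: preferences are encoded by rank functions
(lower rank = more preferred); injectivity makes each a strict linear order.
`rankA a` is woman `a`'s ranking of (man, dog) pairs, `rankB b` is man `b`'s
ranking of (woman, dog) pairs, `rankD d` is dog `d`'s ranking of (woman, man)
pairs. -/
structure GSMPref (n : ℕ) where
  rankA : Fin n → Fin n × Fin n → ℕ
  rankB : Fin n → Fin n × Fin n → ℕ
  rankD : Fin n → Fin n × Fin n → ℕ
  injA : ∀ a, Function.Injective (rankA a)
  injB : ∀ b, Function.Injective (rankB b)
  injD : ∀ d, Function.Injective (rankD d)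

/-- A marriage: woman `i` is in a family with man `toMan i` and dog `toDog i`;
the bijections make the `n` families pairwise disjoint and cover everyone. -/
structure Marriage (n : ℕ) where
  toMan : Fin n ≃ Fin n
  toDog : Fin n ≃ Fin n

/-- The triple (a_i, b_j, d_k) is unstable w.r.t. the marriage `M`: each of the
three strictly prefers the triple to their assigned partners in `M`. -/
def Unstable {n : ℕ} (P : GSMPref n) (M : Marriage n) (i j k : Fin n) : Prop :=
  P.rankA i (j, k) < P.rankA i (M.toMan i, M.toDog i) ∧
  P.rankB j (i, k) < P.rankB j (M.toMan.symm j, M.toDog (M.toMan.symm j)) ∧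
  P.rankD k (i, j) < P.rankD k (M.toDog.symm k, M.toMan (M.toDog.symm k))

/-- The number of unstable triples of the marriage `M`. -/
noncomputable def ins {n : ℕ} (P : GSMPref n) (M : Marriage n) : ℕ :=
  (Finset.univ.filter fun t : Fin n × Fin n × Fin n => Unstable P M t.1 t.2.1 t.2.2).card

/-- The number of stable triples of the marriage `M`. -/
noncomputable def stab {n : ℕ} (P : GSMPref n) (M : Marriage n) : ℕ :=
  n ^ 3 - ins P M

theorem perm_fin_two_eq_refl_or_swap :
    ∀ e : Fin 2 ≃ Fin 2, e = Equiv.refl (Fin 2) ∨ e = Equiv.swap 0 1 := by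
  decide

/-- the 2×2×2 instance with the indicated top preferences
(a1=0,a2=1 in A; b1=0,b2=1 in B; d1=0,d2=1 in D) admits no stable marriage:
every marriage contains an unstable triple. -/
theorem no_stable_marriage_n2 (P : GSMPref 2)
    -- (b1,d1) is a1's most preferred pair
    (ha1 : ∀ p : Fin 2 × Fin 2, p ≠ (0, 0) → P.rankA 0 (0, 0) < P.rankA 0 p)
    -- (b2,d2) is a1's second most preferred pair
    (ha1' : ∀ p : Fin 2 × Fin 2, p ≠ (0, 0) → p ≠ (1, 1) → P.rankA 0 (1, 1) < P.rankA 0 p)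
    -- (b2,d1) is a2's most preferred pair
    (ha2 : ∀ p : Fin 2 × Fin 2, p ≠ (1, 0) → P.rankA 1 (1, 0) < P.rankA 1 p)
    -- (a1,d1) is b1's most preferred pair
    (hb1 : ∀ p : Fin 2 × Fin 2, p ≠ (0, 0) → P.rankB 0 (0, 0) < P.rankB 0 p)
    -- (a1,d2) is b2's most preferred pair
    (hb2 : ∀ p : Fin 2 × Fin 2, p ≠ (0, 1) → P.rankB 1 (0, 1) < P.rankB 1 p)
    -- (a2,d1) is b2's second most preferred pair
    (hb2' : ∀ p : Fin 2 × Fin 2, p ≠ (0, 1) → p ≠ (1, 0) → P.rankB 1 (1, 0) < P.rankB 1 p)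
    -- (a2,b2) is d1's most preferred pair
    (hd1 : ∀ p : Fin 2 × Fin 2, p ≠ (1, 1) → P.rankD 0 (1, 1) < P.rankD 0 p)
    -- (a1,b1) is d1's second most preferred pair
    (hd1' : ∀ p : Fin 2 × Fin 2, p ≠ (1, 1) → p ≠ (0, 0) → P.rankD 0 (0, 0) < P.rankD 0 p)
    -- (a1,b2) is d2's most preferred pair
    (hd2 : ∀ p : Fin 2 × Fin 2, p ≠ (0, 1) → P.rankD 1 (0, 1) < P.rankD 1 p) :
    ∀ M : Marriage 2, ∃ i j k : Fin 2, Unstable P M i j k := by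
  rintro ⟨m, d⟩
  obtain rfl | rfl := perm_fin_two_eq_refl_or_swap m <;>
    obtain rfl | rfl := perm_fin_two_eq_refl_or_swap d
  · exact ⟨1, 1, 0, ha2 _ (by decide), hb2' _ (by decide) (by decide), hd1 _ (by decide)⟩
  · exact ⟨0, 1, 1, ha1' _ (by decide) (by decide), hb2 _ (by decide), hd2 _ (by decide)⟩
  · exact ⟨0, 0, 0, ha1 _ (by decide), hb1 _ (by decide), hd1' _ (by decide) (by decide)⟩
  · exact ⟨0, 0, 0, ha1 _ (by decide), hb1 _ (by decide), hd1' _ (by decide) (by decide)⟩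
end

section
/- For every 3GSM instance of size n ≥ 1, writing A = {a_1,…,a_n}, B = {b_1,…,b_n}, D = {d_1,…,d_n}, there exist indices i, j, k ∈ [n] such that at least two of the following three inequalities hold: |{(β,δ) ∈ [n]² : (b_β,d_δ) ⪰_{a_i} (b_j,d_k)}| ≤ n²/3 + 1; |{(α,δ) ∈ [n]² : (a_α,d_δ) ⪰_{b_j} (a_i,d_k)}| ≤ n²/3 + 1; |{(α,β) ∈ [n]² : (a_α,b_β) ⪰_{d_k} (a_i,b_j)}| ≤ n²/3 + 1. (Here ⪰ denotes 'weakly preferred', i.e. strictly preferred or equal.) -/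
open Classical

/-- At least `k` elements of a finite type of size at least `k` have position at most `k`
in the order induced by an injective rank function. -/
theorem le_card_filter_position_le {α : Type*} [Fintype α] (f : α → ℕ)
    (hf : Function.Injective f) (k : ℕ) (hk : k ≤ Fintype.card α) :
    k ≤ (Finset.univ.filter fun x : α =>
      (Finset.univ.filter fun p : α => f p ≤ f x).card ≤ k).card := by
  set r : α → ℕ := fun x => (Finset.univ.filter fun p : α => f p ≤ f x).card with hr
  have hmono : ∀ x y, f x < f y → r x < r y := by
    intro x y hxy
    apply Finset.card_lt_card
    rw [Finset.ssubset_iff_of_subset]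
    · exact ⟨y, by simp, by simpa using hxy⟩
    · intro p hp
      simp only [Finset.mem_filter, Finset.mem_univ, true_and] at hp ⊢
      omega
  have hinj : Function.Injective r := by
    intro x y hxy
    rcases lt_trichotomy (f x) (f y) with h | h | h
    · exact absurd hxy (hmono x y h).ne
    · exact hf h
    · exact absurd hxy (hmono y x h).ne'
  have hcompl : (Finset.univ.filter fun x : α => ¬ r x ≤ k).card ≤ Fintype.card α - k := by
    rw [← Nat.card_Ioc]
    refine Finset.card_le_card_of_injOn r ?_ hinj.injOn
    intro x hx
    simp only [Finset.coe_filter, Finset.mem_univ, true_and, Set.mem_ofPred_eq, not_le] at hx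
    exact Finset.mem_coe.2 (Finset.mem_Ioc.2 ⟨hx, Finset.card_le_univ _⟩)
  have hsum := Finset.card_filter_add_card_filter_not (s := (Finset.univ : Finset α))
    (fun x => r x ≤ k)
  rw [Finset.card_univ] at hsum
  change k ≤ (Finset.univ.filter fun x : α => r x ≤ k).card
  omega

/-- Three relations on `Fin n`, each with more than a third of the pairs in every section
along its own coordinate, cannot be pairwise disjoint as sets of triples. -/
theorem exists_two_of_three_of_large_sections {n k : ℕ} (hn : 1 ≤ n) (hk : n ^ 2 < 3 * k)
    (RA RB RD : Fin n → Fin n × Fin n → Prop)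
    [∀ i, DecidablePred (RA i)] [∀ j, DecidablePred (RB j)] [∀ l, DecidablePred (RD l)]
    (hA : ∀ i, k ≤ (Finset.univ.filter (RA i)).card)
    (hB : ∀ j, k ≤ (Finset.univ.filter (RB j)).card)
    (hD : ∀ l, k ≤ (Finset.univ.filter (RD l)).card) :
    ∃ i j l, (RA i (j, l) ∧ RB j (i, l)) ∨ (RA i (j, l) ∧ RD l (i, j)) ∨
      (RB j (i, l) ∧ RD l (i, j)) := by
  by_contra! hcon
  have hone : ∀ i j l, (if RA i (j, l) then 1 else 0) + (if RB j (i, l) then 1 else 0) +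
      (if RD l (i, j) then 1 else 0) ≤ 1 := by
    intro i j l
    have := hcon i j l
    split_ifs <;> simp_all
  have hsum : ∀ (R : Fin n → Fin n × Fin n → Prop) [∀ x, DecidablePred (R x)],
      (∀ x, k ≤ (Finset.univ.filter (R x)).card) →
      n * k ≤ ∑ x, ∑ y, ∑ z, if R x (y, z) then 1 else 0 := by
    intro R _ hR
    calc n * k = ∑ _x : Fin n, k := by simp
      _ ≤ ∑ x, (Finset.univ.filter (R x)).card := Finset.sum_le_sum fun x _ => hR x
      _ = _ := by simp only [Finset.card_filter, Fintype.sum_prod_type]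
  have htot : ∑ i, ∑ j, ∑ l, ((if RA i (j, l) then 1 else 0) +
      (if RB j (i, l) then 1 else 0) + (if RD l (i, j) then 1 else 0)) ≤ n ^ 3 := by
    calc _ ≤ ∑ _i : Fin n, ∑ _j : Fin n, ∑ _l : Fin n, 1 :=
          Finset.sum_le_sum fun i _ => Finset.sum_le_sum fun j _ =>
            Finset.sum_le_sum fun l _ => hone i j l
      _ = n ^ 3 := by simp; ring
  simp only [Finset.sum_add_distrib] at htot
  have h1 := hsum RA hA
  have h2 := hsum RB hB
  have h3 := hsum RD hD
  rw [Finset.sum_comm] at h2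
  rw [Finset.sum_comm] at h3
  rw [Finset.sum_congr rfl fun i _ => Finset.sum_comm] at h3
  have hlt : n * n ^ 2 < n * (3 * k) := Nat.mul_lt_mul_of_pos_left hk hn
  have hcube : n ^ 3 = n * n ^ 2 := by ring
  have htriple : n * (3 * k) = n * k + n * k + n * k := by ring
  omega

/-- in every 3GSM instance of size `n ≥ 1` there are indices
`i, j, k` such that at least two of the three players `a_i, b_j, d_k` rank the
corresponding pair among their top `n²/3 + 1` choices (weak preference means
rank at most that of the given pair). -/
theorem exists_doubly_marked_triple {n : ℕ} (hn : 1 ≤ n) (P : GSMPref n) :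
    ∃ i j k : Fin n,
      (((Finset.univ.filter fun p : Fin n × Fin n =>
            P.rankA i p ≤ P.rankA i (j, k)).card : ℝ) ≤ (n : ℝ) ^ 2 / 3 + 1 ∧
        ((Finset.univ.filter fun p : Fin n × Fin n =>
            P.rankB j p ≤ P.rankB j (i, k)).card : ℝ) ≤ (n : ℝ) ^ 2 / 3 + 1) ∨
      (((Finset.univ.filter fun p : Fin n × Fin n =>
            P.rankA i p ≤ P.rankA i (j, k)).card : ℝ) ≤ (n : ℝ) ^ 2 / 3 + 1 ∧
        ((Finset.univ.filter fun p : Fin n × Fin n =>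
            P.rankD k p ≤ P.rankD k (i, j)).card : ℝ) ≤ (n : ℝ) ^ 2 / 3 + 1) ∨
      (((Finset.univ.filter fun p : Fin n × Fin n =>
            P.rankB j p ≤ P.rankB j (i, k)).card : ℝ) ≤ (n : ℝ) ^ 2 / 3 + 1 ∧
        ((Finset.univ.filter fun p : Fin n × Fin n =>
            P.rankD k p ≤ P.rankD k (i, j)).card : ℝ) ≤ (n : ℝ) ^ 2 / 3 + 1) := by
  have hsq : 1 ≤ n ^ 2 := Nat.one_le_pow _ _ hn
  have hk : n ^ 2 / 3 + 1 ≤ Fintype.card (Fin n × Fin n) := by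
    rw [Fintype.card_prod, Fintype.card_fin, ← sq]
    omega
  have hcast : ∀ m : ℕ, m ≤ n ^ 2 / 3 + 1 → (m : ℝ) ≤ (n : ℝ) ^ 2 / 3 + 1 := by
    intro m hm
    have h : 3 * m ≤ n ^ 2 + 3 := by omega
    have h' : 3 * (m : ℝ) ≤ (n : ℝ) ^ 2 + 3 := by exact_mod_cast h
    linarith
  obtain ⟨i, j, l, h⟩ := exists_two_of_three_of_large_sections (k := n ^ 2 / 3 + 1) hn
    (by omega)
    (fun i q => (Finset.univ.filter fun p => P.rankA i p ≤ P.rankA i q).card ≤ n ^ 2 / 3 + 1)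
    (fun j q => (Finset.univ.filter fun p => P.rankB j p ≤ P.rankB j q).card ≤ n ^ 2 / 3 + 1)
    (fun l q => (Finset.univ.filter fun p => P.rankD l p ≤ P.rankD l q).card ≤ n ^ 2 / 3 + 1)
    (fun i => le_card_filter_position_le (P.rankA i) (P.injA i) _ hk)
    (fun j => le_card_filter_position_le (P.rankB j) (P.injB j) _ hk)
    (fun l => le_card_filter_position_le (P.rankD l) (P.injD l) _ hk)
  exact ⟨i, j, l, h.imp (And.imp (hcast _) (hcast _))
    (Or.imp (And.imp (hcast _) (hcast _)) (And.imp (hcast _) (hcast _)))⟩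
end

section
/- For every 3GSM instance of size n ≥ 1 there exists an index triple (i,j,k) ∈ [n]³ whose stable set satisfies |S_{ijk}| ≥ 4n²/3 − n − 1. -/
open Classical

/-- The stable set `S_{ijk}`: index triples `(α,β,δ)` such that `α = i` and
`a_i` weakly prefers `(b_j,d_k)` to `(b_β,d_δ)`, or `β = j` and `b_j` weakly
prefers `(a_i,d_k)` to `(a_α,d_δ)`, or `δ = k` and `d_k` weakly prefers
`(a_i,b_j)` to `(a_α,b_β)`. -/
noncomputable def stableSet {n : ℕ} (P : GSMPref n) (i j k : Fin n) :
    Finset (Fin n × Fin n × Fin n) :=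
  Finset.univ.filter fun t =>
    (t.1 = i ∧ P.rankA i (j, k) ≤ P.rankA i (t.2.1, t.2.2)) ∨
    (t.2.1 = j ∧ P.rankB j (i, k) ≤ P.rankB j (t.1, t.2.2)) ∨
    (t.2.2 = k ∧ P.rankD k (i, j) ≤ P.rankD k (t.1, t.2.1))

/-- If every `y ∈ T x` satisfies `y ∈ S x` or `x ∈ S y`, and every `T x` has at least `m` elements,
then some `S x` has at least `m / 2` elements. -/
theorem exists_le_two_mul_card_of_forall_mem_or_mem {α : Type*} [Fintype α] [Nonempty α]
    (S T : α → Finset α) (m : ℕ) (hm : ∀ x, m ≤ (T x).card)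
    (hT : ∀ x, ∀ y ∈ T x, y ∈ S x ∨ x ∈ S y) :
    ∃ x, m ≤ 2 * (S x).card := by
  have hsum : ∑ _x : α, m ≤ ∑ x, 2 * (S x).card := by
    calc ∑ _x : α, m
        ≤ ∑ x, ((S x).card + (Finset.univ.filter fun y => x ∈ S y).card) := by
          refine Finset.sum_le_sum fun x _ => (hm x).trans ?_
          refine (Finset.card_le_card fun y hy => ?_).trans (Finset.card_union_le _ _)
          simpa using hT x y hy
      _ = ∑ x, 2 * (S x).card := by
          have hswap : ∑ x, (Finset.univ.filter fun y => x ∈ S y).card = ∑ x, (S x).card := by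
            simpa [Finset.bipartiteAbove, Finset.bipartiteBelow] using
              Finset.sum_card_bipartiteAbove_eq_sum_card_bipartiteBelow
                (s := Finset.univ) (t := Finset.univ) fun x y => x ∈ S y
          rw [Finset.sum_add_distrib, hswap, ← Finset.mul_sum, two_mul]
  obtain ⟨x, -, hx⟩ := Finset.exists_le_of_sum_le Finset.univ_nonempty hsum
  exact ⟨x, hx⟩

/-- The number of triples sharing at least one coordinate with a given triple. -/
theorem card_triples_sharing_coordinate {n : ℕ} (t : Fin n × Fin n × Fin n) :
    (Finset.univ.filter fun s : Fin n × Fin n × Fin n =>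
      s.1 = t.1 ∨ s.2.1 = t.2.1 ∨ s.2.2 = t.2.2).card + (n - 1) ^ 3 = n ^ 3 := by
  have hcompl : (Finset.univ.filter fun s : Fin n × Fin n × Fin n =>
      ¬(s.1 = t.1 ∨ s.2.1 = t.2.1 ∨ s.2.2 = t.2.2)) =
        ({t.1}ᶜ : Finset (Fin n)) ×ˢ ({t.2.1}ᶜ : Finset (Fin n)) ×ˢ ({t.2.2}ᶜ : Finset (Fin n)) := by
    ext s
    simp [not_or]
  have hcard := Finset.card_filter_add_card_filter_not (s := Finset.univ)
    fun s : Fin n × Fin n × Fin n => s.1 = t.1 ∨ s.2.1 = t.2.1 ∨ s.2.2 = t.2.2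
  rw [hcompl] at hcard
  simp only [Finset.card_product, Finset.card_compl, Finset.card_singleton, Finset.card_univ,
    Fintype.card_prod, Fintype.card_fin] at hcard
  linarith

/-- Of two triples sharing a coordinate, one lies in the stable set of the other. -/
theorem mem_stableSet_or_mem_stableSet {n : ℕ} (P : GSMPref n) {s t : Fin n × Fin n × Fin n}
    (h : s.1 = t.1 ∨ s.2.1 = t.2.1 ∨ s.2.2 = t.2.2) :
    s ∈ stableSet P t.1 t.2.1 t.2.2 ∨ t ∈ stableSet P s.1 s.2.1 s.2.2 := by
  obtain ⟨a, b, d⟩ := s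
  obtain ⟨i, j, k⟩ := t
  simp only [stableSet, Finset.mem_filter, Finset.mem_univ, true_and] at h ⊢
  rcases h with rfl | rfl | rfl
  · rcases le_total (P.rankA a (j, k)) (P.rankA a (b, d)) with h | h <;> simp [h]
  · rcases le_total (P.rankB b (i, k)) (P.rankB b (a, d)) with h | h <;> simp [h]
  · rcases le_total (P.rankD d (i, j)) (P.rankD d (a, b)) with h | h <;> simp [h]

/-- every 3GSM instance of size `n ≥ 1` has an index triple whose
stable set has size at least `4n²/3 − n − 1`. -/
theorem exists_large_stable_set {n : ℕ} (hn : 1 ≤ n) (P : GSMPref n) :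
    ∃ i j k : Fin n,
      4 * (n : ℝ) ^ 2 / 3 - n - 1 ≤ ((stableSet P i j k).card : ℝ) := by
  obtain ⟨p, rfl⟩ : ∃ p, n = p + 1 := ⟨n - 1, by omega⟩
  obtain ⟨⟨i, j, k⟩, ht⟩ := exists_le_two_mul_card_of_forall_mem_or_mem
    (fun t : Fin (p + 1) × Fin (p + 1) × Fin (p + 1) => stableSet P t.1 t.2.1 t.2.2)
    (fun t => Finset.univ.filter fun s => s.1 = t.1 ∨ s.2.1 = t.2.1 ∨ s.2.2 = t.2.2)
    (3 * p ^ 2 + 3 * p + 1)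
    (fun t => by
      have hcard := card_triples_sharing_coordinate t
      rw [Nat.add_sub_cancel] at hcard
      linarith)
    (fun t s hs => mem_stableSet_or_mem_stableSet P (Finset.mem_filter.mp hs).2)
  refine ⟨i, j, k, ?_⟩
  have ht' : 3 * (p : ℝ) ^ 2 + 3 * p + 1 ≤ 2 * ((stableSet P i j k).card : ℝ) := by
    exact_mod_cast ht
  push_cast
  nlinarith [sq_nonneg ((p : ℝ) - 1)]
end

section
/- There exists a constant C > 0 (independent of n and of the preferences) such that every 3GSM instance of size n admits a marriage M with stab(M) ≥ (4/9)·n³ − C·n²; equivalently, ins(M) ≤ (5/9)·n³ + C·n². In particular, such a marriage is asymptotically a 4/9-factor approximation to the maximally stable marriage. -/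
open Classical

/-- Twice the number of strictly ordered pairs of a finite type is at most the number of pairs. -/
lemma two_mul_sum_card_lt_le {α : Type*} [Fintype α] (r : α → ℕ) :
    2 * ∑ q, (Finset.univ.filter fun p => r p < r q).card ≤ Fintype.card α ^ 2 := by
  simp only [Finset.card_filter]
  have hswap : ∑ q, ∑ p, (if r p < r q then 1 else 0) =
      ∑ q, ∑ p, (if r q < r p then 1 else 0) := Finset.sum_comm
  rw [two_mul]
  nth_rewrite 2 [hswap]
  simp only [← Finset.sum_add_distrib]
  calc ∑ q, ∑ p, ((if r p < r q then 1 else 0) + (if r q < r p then 1 else 0))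
      ≤ ∑ _q : α, ∑ _p : α, 1 := by
        refine Finset.sum_le_sum fun q _ => Finset.sum_le_sum fun p _ => ?_
        split_ifs <;> omega
    _ = Fintype.card α ^ 2 := by simp [sq]

/-- The instability of a marriage is bounded by the total number of pairs that the women strictly
prefer to their assigned partners. -/
lemma ins_le_sum_rankA {n : ℕ} (P : GSMPref n) (M : Marriage n) :
    ins P M ≤ ∑ i, (Finset.univ.filter fun p =>
      P.rankA i p < P.rankA i (M.toMan i, M.toDog i)).card := by
  rw [← Finset.card_sigma]
  refine Finset.card_le_card_of_injOn (fun t => ⟨t.1, t.2⟩) ?_ ?_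
  · intro t ht
    simp only [Finset.coe_filter, Finset.mem_univ, true_and, Set.mem_ofPred_eq] at ht
    simpa using ht.1
  · rintro ⟨i, p⟩ _ ⟨j, q⟩ _ h
    simpa using h

/-- The marriage assigning man `i + q.1` and dog `i + q.2` to woman `i`. -/
def shiftMarriage {n : ℕ} [NeZero n] (q : Fin n × Fin n) : Marriage n :=
  ⟨Equiv.addRight q.1, Equiv.addRight q.2⟩

/-- Averaging over all cyclic shifts, some marriage makes at most half of all triples unstable. -/
lemma exists_two_mul_ins_le {n : ℕ} (P : GSMPref n) : ∃ M : Marriage n, 2 * ins P M ≤ n ^ 3 := by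
  rcases Nat.eq_zero_or_pos n with rfl | hn
  · exact ⟨⟨Equiv.refl _, Equiv.refl _⟩, by simp [ins]⟩
  have : NeZero n := ⟨hn.ne'⟩
  have hshift (i : Fin n) :
      ∑ q : Fin n × Fin n, (Finset.univ.filter fun p =>
        P.rankA i p < P.rankA i (i + q.1, i + q.2)).card =
      ∑ q, (Finset.univ.filter fun p => P.rankA i p < P.rankA i q).card :=
    Equiv.sum_comp (Equiv.addLeft ((i, i) : Fin n × Fin n)) fun q =>
      (Finset.univ.filter fun p => P.rankA i p < P.rankA i q).card
  have hsum : ∑ q : Fin n × Fin n, 2 * ins P (shiftMarriage q) ≤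
      ∑ _q : Fin n × Fin n, n ^ 3 :=
    calc ∑ q : Fin n × Fin n, 2 * ins P (shiftMarriage q)
        ≤ ∑ q : Fin n × Fin n, 2 * ∑ i, (Finset.univ.filter fun p =>
            P.rankA i p < P.rankA i (i + q.1, i + q.2)).card :=
          Finset.sum_le_sum fun q _ => Nat.mul_le_mul_left 2 (ins_le_sum_rankA P (shiftMarriage q))
      _ = ∑ i, 2 * ∑ q, (Finset.univ.filter fun p => P.rankA i p < P.rankA i q).card := by
          rw [← Finset.mul_sum, Finset.sum_comm, Finset.mul_sum]
          simp only [hshift]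
      _ ≤ ∑ _i : Fin n, Fintype.card (Fin n × Fin n) ^ 2 :=
          Finset.sum_le_sum fun i _ => two_mul_sum_card_lt_le (P.rankA i)
      _ = ∑ _q : Fin n × Fin n, n ^ 3 := by
          simp only [Finset.sum_const, Finset.card_univ, Fintype.card_prod, Fintype.card_fin,
            smul_eq_mul]
          ring
  obtain ⟨q, _, hq⟩ := Finset.exists_le_of_sum_le Finset.univ_nonempty hsum
  exact ⟨shiftMarriage q, hq⟩

/-- there is an absolute constant `C > 0` such that every 3GSM
instance of size `n` admits a marriage `M` with
`stab(M) ≥ (4/9)n³ − C·n²`, equivalently `ins(M) ≤ (5/9)n³ + C·n²`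
(asymptotically a 4/9-factor approximation to the maximally stable marriage). -/
theorem amsm_approximation :
    ∃ C : ℝ, 0 < C ∧ ∀ (n : ℕ) (P : GSMPref n), ∃ M : Marriage n,
      (4 / 9) * (n : ℝ) ^ 3 - C * (n : ℝ) ^ 2 ≤ (stab P M : ℝ) ∧
      (ins P M : ℝ) ≤ (5 / 9) * (n : ℝ) ^ 3 + C * (n : ℝ) ^ 2 := by
  refine ⟨1, one_pos, fun n P => ?_⟩
  obtain ⟨M, hM⟩ := exists_two_mul_ins_le P
  have hle : ins P M ≤ n ^ 3 := by omega
  have hM' : 2 * (ins P M : ℝ) ≤ (n : ℝ) ^ 3 := by exact_mod_cast hM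
  have h3 : (0 : ℝ) ≤ (n : ℝ) ^ 3 := by positivity
  have h2 : (0 : ℝ) ≤ (n : ℝ) ^ 2 := by positivity
  refine ⟨M, ?_, by linarith⟩
  rw [stab, Nat.cast_sub hle]
  push_cast
  linarith
end

section
/- In a 3GSM instance of size n, let S be a stable submarriage of cardinality s, and let M be any marriage with S ⊆ M. Then ins(M) ≤ 3·(n − s)·n²; that is, every unstable triple of M involves a player from one of the n − s families of M not in S, and each such family induces at most 3n² unstable triples. -/
open Classical

/-- if `M` is a marriage extending a stable submarriage `S`
(here `S` consists of the families of `M` indexed by the women in `I`;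
stability of `S` says no triple of players married in `S` is unstable with
respect to their `S`-partners, which coincide with their `M`-partners), then
`ins(M) ≤ 3·(n − |S|)·n²`. -/
theorem ins_le_of_stable_submarriage {n : ℕ} (P : GSMPref n) (M : Marriage n)
    (I : Finset (Fin n))
    (hstable : ∀ i ∈ I, ∀ i' ∈ I, ∀ i'' ∈ I,
      ¬ Unstable P M i (M.toMan i') (M.toDog i'')) :
    ins P M ≤ 3 * (n - I.card) * n ^ 2 := by
  have hsub : (Finset.univ.filter fun t : Fin n × Fin n × Fin n =>
      Unstable P M t.1 t.2.1 t.2.2) ⊆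
      (Iᶜ ×ˢ Finset.univ ×ˢ Finset.univ ∪
        Finset.univ ×ˢ Iᶜ.map M.toMan.toEmbedding ×ˢ Finset.univ) ∪
        Finset.univ ×ˢ Finset.univ ×ˢ Iᶜ.map M.toDog.toEmbedding := by
    rintro ⟨i, j, k⟩ ht
    obtain ⟨j, rfl⟩ := M.toMan.surjective j
    obtain ⟨k, rfl⟩ := M.toDog.surjective k
    have hu : Unstable P M i (M.toMan j) (M.toDog k) := (Finset.mem_filter.mp ht).2
    by_contra hnot
    have hI : i ∈ I ∧ j ∈ I ∧ k ∈ I := by simpa [and_assoc] using hnot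
    exact hstable i hI.1 j hI.2.1 k hI.2.2 hu
  calc
    ins P M ≤ _ := Finset.card_le_card hsub
    _ ≤ _ := (Finset.card_union_le _ _).trans
      (Nat.add_le_add_right (Finset.card_union_le _ _) _)
    _ = 3 * (n - I.card) * n ^ 2 := by
      simp only [Finset.card_product, Finset.card_map, Finset.card_compl, Finset.card_univ,
        Fintype.card_fin]
      ring
end

section
/- In a 3GSM instance of size n, for every ε > 0: if some stable submarriage has cardinality greater than (1 − ε)·n, then some marriage M satisfies stab(M) > (1 − 3ε)·n³. Equivalently, if every marriage M satisfies stab(M) ≤ (1 − 3ε)·n³, then every stable submarriage has cardinality at most (1 − ε)·n. -/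
open Classical

/-- A stable submarriage of `M` with index set `I` contributes `|I|³` stable triples of `M`. -/
theorem card_pow_three_le_stab {n : ℕ} (P : GSMPref n) (M : Marriage n) (I : Finset (Fin n))
    (hI : ∀ i ∈ I, ∀ i' ∈ I, ∀ i'' ∈ I, ¬ Unstable P M i (M.toMan i') (M.toDog i'')) :
    I.card ^ 3 ≤ stab P M := by
  have hcard : ins P M + (Finset.univ.filter fun t : Fin n × Fin n × Fin n =>
      ¬ Unstable P M t.1 t.2.1 t.2.2).card = n ^ 3 := by
    rw [ins, Finset.card_filter_add_card_filter_not]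
    simp [pow_three]
  have hle : (I ×ˢ (I.map M.toMan.toEmbedding ×ˢ I.map M.toDog.toEmbedding)).card ≤
      (Finset.univ.filter fun t : Fin n × Fin n × Fin n =>
        ¬ Unstable P M t.1 t.2.1 t.2.2).card := by
    refine Finset.card_le_card fun ⟨i, j, k⟩ ht => ?_
    simp only [Finset.mem_product, Finset.mem_map] at ht
    obtain ⟨hi, ⟨i', hi', rfl⟩, ⟨i'', hi'', rfl⟩⟩ := ht
    simpa using hI i hi i' hi' i'' hi''
  rw [Finset.card_product, Finset.card_product, Finset.card_map, Finset.card_map,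
    ← pow_three] at hle
  rw [stab]
  omega

/-- A cubic form of Bernoulli's inequality. -/
theorem one_sub_three_mul_mul_pow_three_lt {x y ε : ℝ} (hx : 0 < x) (hy : 0 ≤ y)
    (hxy : (1 - ε) * x < y) : (1 - 3 * ε) * x ^ 3 < y ^ 3 := by
  rcases le_or_gt ε 1 with h | h
  · calc (1 - 3 * ε) * x ^ 3 ≤ (1 - ε) ^ 3 * x ^ 3 := by
          gcongr
          nlinarith [mul_nonneg (sq_nonneg ε) (sub_nonneg.2 h)]
      _ = ((1 - ε) * x) ^ 3 := (mul_pow _ _ _).symm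
      _ < y ^ 3 := pow_lt_pow_left₀ hxy (mul_nonneg (sub_nonneg.2 h) hx.le) three_ne_zero
  · exact (mul_neg_of_neg_of_pos (by linarith) (by positivity)).trans_le (by positivity)

/-- for every `ε > 0`, if some stable submarriage has cardinality
greater than `(1 − ε)n` (a submarriage is given by a marriage `M₀` together
with the index set `I` of its families that form the submarriage; stability
says no triple of players married in the submarriage is unstable with respect
to their assigned partners), then some marriage `M` has
`stab(M) > (1 − 3ε)n³`. -/
theorem stab_of_large_stable_submarriage {n : ℕ} (P : GSMPref n) (ε : ℝ)
    (hε : 0 < ε)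
    (h : ∃ (M₀ : Marriage n) (I : Finset (Fin n)),
      (∀ i ∈ I, ∀ i' ∈ I, ∀ i'' ∈ I,
        ¬ Unstable P M₀ i (M₀.toMan i') (M₀.toDog i'')) ∧
      (1 - ε) * (n : ℝ) < (I.card : ℝ)) :
    ∃ M : Marriage n, (1 - 3 * ε) * (n : ℝ) ^ 3 < (stab P M : ℝ) := by
  obtain ⟨M₀, I, hI, hcard⟩ := h
  refine ⟨M₀, lt_of_lt_of_le (one_sub_three_mul_mul_pow_three_lt ?_ I.card.cast_nonneg hcard)
    (mod_cast card_pow_three_le_stab P M₀ I hI)⟩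
  rcases n.eq_zero_or_pos with rfl | hn
  · simp [Finset.eq_empty_of_isEmpty I] at hcard
  · exact_mod_cast hn
end

section
/- There exists a constant C > 0 (independent of n and of the preferences) such that every 3PSA instance of size n ≥ 1 contains a triple t ∈ C(U,3) whose stable set satisfies |S_t| ≥ 6n² − C·n. -/
open Classical

/-- A 3PSA instance of size `n`: a set `U` of `3n` players (modeled as
`Fin (3*n)`), each player `u` ranking the 2-element subsets of `U \ {u}` by a
rank function (lower rank = more preferred), injective on such pairs so that
it encodes a strict linear order. -/
structure PSAPref (n : ℕ) where
  rank : Fin (3 * n) → Finset (Fin (3 * n)) → ℕ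
  inj : ∀ u, Set.InjOn (rank u) {s : Finset (Fin (3 * n)) | s.card = 2 ∧ u ∉ s}

/-- The stable set `S_t` of a triple `t`: the triples `t'` such that some
player `p ∈ t ∩ t'` weakly prefers the pair `t \ {p}` to the pair `t' \ {p}`. -/
noncomputable def stableSetPSA {n : ℕ} (P : PSAPref n) (t : Finset (Fin (3 * n))) :
    Finset (Finset (Fin (3 * n))) :=
  Finset.univ.filter fun t' => t'.card = 3 ∧
    ∃ p ∈ t ∩ t', P.rank p (t.erase p) ≤ P.rank p (t'.erase p)

/-- The binomial count of triples meeting a fixed triple, in quadratic form. -/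
lemma choose_three_sub_choose_three (m : ℕ) :
    ((m + 3).choose 3 : ℝ) - (m.choose 3 : ℝ) = (3 * (m : ℝ) ^ 2 + 3 * m + 2) / 2 := by
  have h : (m + 3).choose 3 =
      (m + 2).choose 2 + ((m + 1).choose 2 + (m.choose 2 + m.choose 3)) := by
    rw [Nat.choose_succ_succ' (m + 2) 2, Nat.choose_succ_succ' (m + 1) 2,
      Nat.choose_succ_succ' m 2]
  rw [h]
  push_cast [Nat.cast_choose_two]
  ring

lemma mem_stableSetPSA {n : ℕ} (P : PSAPref n) (t t' : Finset (Fin (3 * n))) :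
    t' ∈ stableSetPSA P t ↔ t'.card = 3 ∧
      ∃ p ∈ t ∩ t', P.rank p (t.erase p) ≤ P.rank p (t'.erase p) := by
  simp [stableSetPSA]

/-- Of two triples that meet, at least one lies in the stable set of the other. -/
lemma mem_stableSetPSA_or_mem {n : ℕ} (P : PSAPref n) {t t' : Finset (Fin (3 * n))}
    (ht : t.card = 3) (ht' : t'.card = 3) (h : ¬Disjoint t t') :
    t' ∈ stableSetPSA P t ∨ t ∈ stableSetPSA P t' := by
  obtain ⟨p, hp, hp'⟩ := Finset.not_disjoint_iff.mp h
  rw [mem_stableSetPSA, mem_stableSetPSA]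
  rcases le_total (P.rank p (t.erase p)) (P.rank p (t'.erase p)) with hle | hle
  · exact Or.inl ⟨ht', p, Finset.mem_inter.mpr ⟨hp, hp'⟩, hle⟩
  · exact Or.inr ⟨ht, p, Finset.mem_inter.mpr ⟨hp', hp⟩, hle⟩

/-- The number of triples disjoint from a fixed triple, plus the number of those that meet it. -/
lemma choose_add_card_filter_not_disjoint {α : Type*} [Fintype α] [DecidableEq α]
    (t : Finset α) (k : ℕ) :
    (Fintype.card α - t.card).choose k +
      ((Finset.powersetCard k Finset.univ).filter fun t' => ¬Disjoint t t').card =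
        (Fintype.card α).choose k := by
  have h : (Finset.powersetCard k Finset.univ).filter (fun t' => Disjoint t t') =
      Finset.powersetCard k tᶜ := by
    ext s
    simp [Finset.mem_powersetCard, Finset.subset_compl_iff_disjoint_left, and_comm]
  rw [← Finset.card_compl, ← Finset.card_powersetCard, ← h,
    Finset.card_filter_add_card_filter_not, Finset.card_powersetCard, Finset.card_univ]

/-- Some triple has a stable set containing at least half as many triples as meet it. -/
lemma exists_choose_le_two_mul_card_stableSetPSA {n : ℕ} (hn : 1 ≤ n) (P : PSAPref n) :
    ∃ t : Finset (Fin (3 * n)), t.card = 3 ∧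
      (3 * n).choose 3 ≤ (3 * n - 3).choose 3 + 2 * (stableSetPSA P t).card := by
  set T : Finset (Finset (Fin (3 * n))) := Finset.powersetCard 3 Finset.univ with hT
  have mem_T (t : Finset (Fin (3 * n))) : t ∈ T ↔ t.card = 3 := by simp [hT]
  have hne : T.Nonempty := Finset.powersetCard_nonempty.mpr (by simp; omega)
  have hS (t : Finset (Fin (3 * n))) :
      (T.filter fun t' => t' ∈ stableSetPSA P t) = stableSetPSA P t := by
    ext t'
    rw [Finset.mem_filter, mem_T, mem_stableSetPSA]
    tauto
  have hswap : ∑ t ∈ T, (T.filter fun t' => t ∈ stableSetPSA P t').card =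
      ∑ t ∈ T, (stableSetPSA P t).card := by
    calc _ = ∑ t ∈ T, (T.filter fun t' => t' ∈ stableSetPSA P t).card :=
          Finset.sum_card_bipartiteAbove_eq_sum_card_bipartiteBelow
            fun t t' => t ∈ stableSetPSA P t'
      _ = _ := by simp only [hS]
  have hlocal : ∀ t ∈ T, (3 * n).choose 3 ≤ (3 * n - 3).choose 3 +
      ((stableSetPSA P t).card + (T.filter fun t' => t ∈ stableSetPSA P t').card) := by
    intro t ht
    have hcount := choose_add_card_filter_not_disjoint t 3
    rw [Fintype.card_fin, (mem_T t).mp ht, ← hT] at hcount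
    rw [← hcount]
    refine Nat.add_le_add_left ((Finset.card_le_card fun t' h => ?_).trans
      (Finset.card_union_le _ _)) _
    obtain ⟨ht', hd⟩ := Finset.mem_filter.mp h
    rw [Finset.mem_union, Finset.mem_filter]
    exact (mem_stableSetPSA_or_mem P ((mem_T t).mp ht) ((mem_T t').mp ht') hd).imp_right
      fun h => ⟨ht', h⟩
  have hsum : ∑ _t ∈ T, (3 * n).choose 3 ≤
      ∑ t ∈ T, ((3 * n - 3).choose 3 + 2 * (stableSetPSA P t).card) := by
    refine (Finset.sum_le_sum hlocal).trans_eq ?_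
    simp only [Finset.sum_add_distrib, hswap, two_mul]
  obtain ⟨t, ht, h⟩ := Finset.exists_le_of_sum_le hne hsum
  exact ⟨t, (mem_T t).mp ht, h⟩

/-- there is an absolute constant `C > 0` such that every 3PSA
instance of size `n ≥ 1` contains a triple `t` with `|S_t| ≥ 6n² − C·n`. -/
theorem exists_large_stable_set_psa :
    ∃ C : ℝ, 0 < C ∧ ∀ n : ℕ, 1 ≤ n → ∀ P : PSAPref n,
      ∃ t : Finset (Fin (3 * n)), t.card = 3 ∧
        6 * (n : ℝ) ^ 2 - C * (n : ℝ) ≤ ((stableSetPSA P t).card : ℝ) := by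
  refine ⟨12, by norm_num, fun n hn P => ?_⟩
  obtain ⟨t, ht, h⟩ := exists_choose_le_two_mul_card_stableSetPSA hn P
  refine ⟨t, ht, ?_⟩
  have hchoose := choose_three_sub_choose_three (3 * n - 3)
  rw [Nat.sub_add_cancel (by omega), Nat.cast_sub (by omega)] at hchoose
  push_cast at hchoose
  have hcast : ((3 * n).choose 3 : ℝ) ≤
      ((3 * n - 3).choose 3 : ℝ) + 2 * ((stableSetPSA P t).card : ℝ) := by
    exact_mod_cast h
  nlinarith [sq_nonneg (n : ℝ), (Nat.cast_nonneg n : (0 : ℝ) ≤ n)]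
end

section
/- There exists a constant C > 0 (independent of n and of the preferences) such that every 3PSA instance of size n admits a matching M with stab(M) ≥ 2n³ − C·n². Since the total number of triples |C(U,3)| = C(3n,3) = (9/2)n³ − O(n²), such a matching is asymptotically a 4/9-factor approximation to the maximally stable matching. -/
open Classical

/-- A matching: a partition of the `3n` players into triples. -/
def IsMatching {n : ℕ} (M : Finset (Finset (Fin (3 * n)))) : Prop :=
  (∀ t ∈ M, t.card = 3) ∧ ∀ u : Fin (3 * n), ∃! t, t ∈ M ∧ u ∈ t

/-- A triple `t'` is unstable w.r.t. the matching `M`: each of its three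
players strictly prefers the pair of other players of `t'` to the pair of its
assigned partners in `M`. -/
def UnstablePSA {n : ℕ} (P : PSAPref n) (M : Finset (Finset (Fin (3 * n))))
    (t' : Finset (Fin (3 * n))) : Prop :=
  t'.card = 3 ∧ ∀ u ∈ t', ∀ t ∈ M, u ∈ t →
    P.rank u (t'.erase u) < P.rank u (t.erase u)

/-- The number of stable triples (3-element subsets that are not unstable). -/
noncomputable def stabPSA {n : ℕ} (P : PSAPref n)
    (M : Finset (Finset (Fin (3 * n)))) : ℕ :=
  (Finset.univ.filter fun t' : Finset (Fin (3 * n)) =>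
    t'.card = 3 ∧ ¬ UnstablePSA P M t').card

/-- The number of unstable triples. -/
noncomputable def insPSA {n : ℕ} (P : PSAPref n)
    (M : Finset (Finset (Fin (3 * n)))) : ℕ :=
  (Finset.univ.filter fun t' : Finset (Fin (3 * n)) => UnstablePSA P M t').card

section Averaging

open Finset

variable {α : Type*}

/-- Partitions of `α` into triples. -/
def IsTriplePartition (M : Finset (Finset α)) : Prop :=
  (∀ t ∈ M, #t = 3) ∧ ∀ u : α, ∃! t, t ∈ M ∧ u ∈ t

lemma IsTriplePartition.map {M : Finset (Finset α)} (hM : IsTriplePartition M)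
    (g : Equiv.Perm α) :
    IsTriplePartition (M.map (Finset.mapEmbedding g.toEmbedding).toEmbedding) := by
  refine ⟨fun t ht => ?_, fun u => ?_⟩
  · obtain ⟨s, hs, rfl⟩ := Finset.mem_map.1 ht
    simpa using hM.1 s hs
  · obtain ⟨s, ⟨hs, hu⟩, huniq⟩ := hM.2 (g.symm u)
    refine ⟨s.map g.toEmbedding, ⟨Finset.mem_map.2 ⟨s, hs, rfl⟩, ?_⟩, ?_⟩
    · exact Finset.mem_map.2 ⟨_, hu, by simp⟩
    · rintro t ⟨ht, hut⟩
      obtain ⟨s', hs', rfl⟩ := Finset.mem_map.1 ht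
      obtain ⟨y, hy, hyu⟩ := Finset.mem_map.1 hut
      have : s' = s := huniq s' ⟨hs', by rw [← hyu]; simpa using hy⟩
      rw [this]; rfl

variable [Fintype α] [DecidableEq α]

lemma exists_perm_map_eq {s t : Finset α} (h : #s = #t) :
    ∃ g : Equiv.Perm α, s.map g.toEmbedding = t := by
  refine ⟨(Finset.equivOfCardEq h).extendSubtype, Finset.eq_of_subset_of_card_le ?_ ?_⟩
  · intro x hx
    obtain ⟨y, hy, rfl⟩ := Finset.mem_map.1 hx
    exact Equiv.extendSubtype_mem _ y hy
  · simp [h]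

/-- Any two triples lie in the same number of partitions into triples. -/
lemma card_triplePartition_mem_le {s t : Finset α} (h : #s = #t) :
    #{M : Finset (Finset α) | IsTriplePartition M ∧ s ∈ M} ≤
      #{M : Finset (Finset α) | IsTriplePartition M ∧ t ∈ M} := by
  obtain ⟨g, rfl⟩ := exists_perm_map_eq h
  refine Finset.card_le_card_of_injOn
    (fun M => M.map (Finset.mapEmbedding g.toEmbedding).toEmbedding) ?_
    (Finset.map_injective _).injOn
  intro M hM
  simp only [Finset.coe_filter, Finset.mem_univ, true_and, Set.mem_ofPred_eq] at hM ⊢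
  exact ⟨hM.1.map g, Finset.mem_map.2 ⟨s, hM.2, rfl⟩⟩

lemma two_mul_card_lt_le {β : Type*} (A : Finset β) (f : β → ℕ) :
    2 * ∑ t ∈ A, ∑ s ∈ A, (if f t < f s then 1 else 0) ≤ #A * #A := by
  have hswap : ∑ t ∈ A, ∑ s ∈ A, (if f t < f s then 1 else 0) =
      ∑ t ∈ A, ∑ s ∈ A, (if f s < f t then 1 else 0) := Finset.sum_comm
  calc 2 * ∑ t ∈ A, ∑ s ∈ A, (if f t < f s then 1 else 0)
      = ∑ t ∈ A, ∑ s ∈ A, ((if f t < f s then 1 else 0) + (if f s < f t then 1 else 0)) := by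
        simp only [Finset.sum_add_distrib]; rw [← hswap]; ring
    _ ≤ ∑ t ∈ A, ∑ s ∈ A, 1 := by
        gcongr with t _ s _
        split_ifs <;> omega
    _ = #A * #A := by simp

/-- Averaged over all partitions into triples, a player `u` prefers at most half of the triples
through `u` to the triple assigned to `u`. -/
lemma two_mul_sum_card_preferred_le (f : Finset α → ℕ) (u : α) :
    2 * ∑ M : Finset (Finset α) with IsTriplePartition M,
        #{t : Finset α | (#t = 3 ∧ u ∈ t) ∧ ∀ s ∈ M, u ∈ s → f t < f s} ≤
      #{M : Finset (Finset α) | IsTriplePartition M} * #{t : Finset α | #t = 3 ∧ u ∈ t} := by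
  set P : Finset (Finset (Finset α)) := {M | IsTriplePartition M} with hP
  set A : Finset (Finset α) := {t | #t = 3 ∧ u ∈ t} with hA
  obtain hA0 | ⟨t₀, ht₀⟩ := A.eq_empty_or_nonempty
  · have : ∀ M : Finset (Finset α),
        #{t : Finset α | (#t = 3 ∧ u ∈ t) ∧ ∀ s ∈ M, u ∈ s → f t < f s} = 0 := by
      intro M
      rw [← Finset.filter_filter, ← hA, hA0]; simp
    simp [this]
  set K := #{M : Finset (Finset α) | IsTriplePartition M ∧ t₀ ∈ M} with hK
  have hcard : ∀ s ∈ A, ∑ M ∈ P, (if s ∈ M then 1 else 0) = K := by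
    intro s hs
    have h3 : #s = #t₀ := by
      rw [(Finset.mem_filter.1 hs).2.1, (Finset.mem_filter.1 ht₀).2.1]
    rw [← Finset.card_filter, hP, Finset.filter_filter]
    exact (card_triplePartition_mem_le h3).antisymm (card_triplePartition_mem_le h3.symm)
  have hone : ∀ M ∈ P, ∑ s ∈ A, (if s ∈ M then 1 else 0) = 1 := by
    intro M hM
    have hM' : IsTriplePartition M := (Finset.mem_filter.1 hM).2
    obtain ⟨s, ⟨hs, hu⟩, huniq⟩ := hM'.2 u
    rw [← Finset.card_filter, Finset.card_eq_one]
    refine ⟨s, Finset.ext fun t => ?_⟩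
    simp only [hA, Finset.mem_filter, Finset.mem_univ, true_and, Finset.mem_singleton]
    constructor
    · rintro ⟨⟨_, h⟩, h'⟩; exact huniq t ⟨h', h⟩
    · rintro rfl; exact ⟨⟨hM'.1 _ hs, hu⟩, hs⟩
  have hPK : #P = #A * K := by
    calc #P = ∑ M ∈ P, ∑ s ∈ A, (if s ∈ M then 1 else 0) := by
          rw [Finset.sum_congr rfl hone]; simp
      _ = #A * K := by rw [Finset.sum_comm, Finset.sum_congr rfl hcard]; simp
  have hle : ∀ M ∈ P,
      #{t : Finset α | (#t = 3 ∧ u ∈ t) ∧ ∀ s ∈ M, u ∈ s → f t < f s} ≤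
        ∑ t ∈ A, ∑ s ∈ A, (if f t < f s then 1 else 0) * (if s ∈ M then 1 else 0) := by
    intro M hM
    have hM' : IsTriplePartition M := (Finset.mem_filter.1 hM).2
    obtain ⟨s, ⟨hs, hu⟩, -⟩ := hM'.2 u
    have hsA : s ∈ A := Finset.mem_filter.2 ⟨Finset.mem_univ _, hM'.1 s hs, hu⟩
    rw [← Finset.filter_filter, ← hA, Finset.card_filter]
    gcongr with t ht
    split_ifs with h
    · refine le_trans ?_ (Finset.single_le_sum (fun _ _ => Nat.zero_le _) hsA)
      simp [h s hs hu, hs]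
    · exact Nat.zero_le _
  calc 2 * ∑ M ∈ P, #{t : Finset α | (#t = 3 ∧ u ∈ t) ∧ ∀ s ∈ M, u ∈ s → f t < f s}
      ≤ 2 * ∑ M ∈ P, ∑ t ∈ A, ∑ s ∈ A,
          (if f t < f s then 1 else 0) * (if s ∈ M then 1 else 0) :=
        Nat.mul_le_mul_left _ (Finset.sum_le_sum hle)
    _ = 2 * (∑ t ∈ A, ∑ s ∈ A, (if f t < f s then 1 else 0)) * K := by
        rw [Finset.sum_comm, mul_assoc, Finset.sum_mul]
        congr 1
        refine Finset.sum_congr rfl fun t _ => ?_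
        rw [Finset.sum_comm, Finset.sum_mul]
        refine Finset.sum_congr rfl fun s hs => ?_
        rw [← Finset.mul_sum, hcard s hs]
    _ ≤ #A * #A * K := Nat.mul_le_mul_right _ (two_mul_card_lt_le A f)
    _ = #P * #A := by rw [hPK]; ring

lemma sum_card_filter_mem (p : Finset α → α → Prop) [∀ t u, Decidable (p t u)] :
    ∑ u : α, #{t : Finset α | (#t = 3 ∧ u ∈ t) ∧ p t u} =
      ∑ t : Finset α with #t = 3, #{u ∈ t | p t u} := by
  simp only [Finset.card_filter]
  rw [Finset.sum_comm, Finset.sum_filter]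
  refine Finset.sum_congr rfl fun t _ => ?_
  by_cases h : #t = 3
  · simp only [h, true_and, if_true, ite_and]
    rw [← Finset.sum_filter]
    simp
  · simp [h]

/-- If a partition into triples exists, then for some partition at most half of all triples
are preferred by all three of their members to their assigned triples. -/
lemma exists_triplePartition_two_mul_card_le (r : α → Finset α → ℕ)
    (hne : ∃ M : Finset (Finset α), IsTriplePartition M) :
    ∃ M : Finset (Finset α), IsTriplePartition M ∧
      2 * #{t : Finset α | #t = 3 ∧ ∀ u ∈ t, ∀ s ∈ M, u ∈ s → r u t < r u s} ≤
        #{t : Finset α | #t = 3} := by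
  set P : Finset (Finset (Finset α)) := {M | IsTriplePartition M} with hP
  have hPne : P.Nonempty := by
    obtain ⟨M, hM⟩ := hne
    exact ⟨M, Finset.mem_filter.2 ⟨Finset.mem_univ _, hM⟩⟩
  have hunst : ∀ M : Finset (Finset α),
      3 * #{t : Finset α | #t = 3 ∧ ∀ u ∈ t, ∀ s ∈ M, u ∈ s → r u t < r u s} ≤
        ∑ u : α, #{t : Finset α | (#t = 3 ∧ u ∈ t) ∧ ∀ s ∈ M, u ∈ s → r u t < r u s} := by
    intro M
    rw [sum_card_filter_mem fun t u => ∀ s ∈ M, u ∈ s → r u t < r u s, ← Finset.filter_filter,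
      Finset.card_filter, Finset.mul_sum]
    refine Finset.sum_le_sum fun t ht => ?_
    split_ifs with h
    · rw [Finset.filter_true_of_mem h, (Finset.mem_filter.1 ht).2, mul_one]
    · simp
  have htot : ∑ u : α, #{t : Finset α | #t = 3 ∧ u ∈ t} = 3 * #{t : Finset α | #t = 3} := by
    have := sum_card_filter_mem (α := α) fun _ _ => True
    simp only [and_true, Finset.filter_true] at this
    rw [this, Finset.sum_congr rfl fun t ht => (Finset.mem_filter.1 ht).2]
    simp [mul_comm]
  have hsum : ∑ M ∈ P,
      2 * #{t : Finset α | #t = 3 ∧ ∀ u ∈ t, ∀ s ∈ M, u ∈ s → r u t < r u s} ≤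
        ∑ M ∈ P, #{t : Finset α | #t = 3} := by
    refine Nat.le_of_mul_le_mul_left ?_ (by norm_num : 0 < 3)
    calc 3 * ∑ M ∈ P,
          2 * #{t : Finset α | #t = 3 ∧ ∀ u ∈ t, ∀ s ∈ M, u ∈ s → r u t < r u s}
        = 2 * ∑ M ∈ P,
          3 * #{t : Finset α | #t = 3 ∧ ∀ u ∈ t, ∀ s ∈ M, u ∈ s → r u t < r u s} := by
          simp only [← Finset.mul_sum]; ring
      _ ≤ 2 * ∑ M ∈ P, ∑ u : α,
          #{t : Finset α | (#t = 3 ∧ u ∈ t) ∧ ∀ s ∈ M, u ∈ s → r u t < r u s} :=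
          Nat.mul_le_mul_left _ (Finset.sum_le_sum fun M _ => hunst M)
      _ = ∑ u : α, 2 * ∑ M ∈ P,
          #{t : Finset α | (#t = 3 ∧ u ∈ t) ∧ ∀ s ∈ M, u ∈ s → r u t < r u s} := by
          rw [Finset.sum_comm, Finset.mul_sum]
      _ ≤ ∑ u : α, #P * #{t : Finset α | #t = 3 ∧ u ∈ t} :=
          Finset.sum_le_sum fun u _ => two_mul_sum_card_preferred_le (r u) u
      _ = 3 * ∑ M ∈ P, #{t : Finset α | #t = 3} := by
          rw [← Finset.mul_sum, htot, Finset.sum_const, smul_eq_mul]; ring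
  obtain ⟨M, hM, h⟩ := Finset.exists_le_of_sum_le hPne hsum
  exact ⟨M, (Finset.mem_filter.1 hM).2, h⟩

end Averaging

lemma exists_isTriplePartition_fin (n : ℕ) :
    ∃ M : Finset (Finset (Fin (3 * n))), IsTriplePartition M := by
  let block (i : Fin n) : Finset (Fin (3 * n)) :=
    Finset.univ.filter fun x => x.val / 3 = i.val
  refine ⟨Finset.univ.image block, ?_, fun u => ?_⟩
  · intro t ht
    obtain ⟨i, -, rfl⟩ := Finset.mem_image.1 ht
    rw [Finset.card_eq_three]
    refine ⟨⟨3 * i, by omega⟩, ⟨3 * i + 1, by omega⟩, ⟨3 * i + 2, by omega⟩, ?_, ?_, ?_, ?_⟩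
    · simp
    · simp
    · simp
    · ext x
      simp only [block, Finset.mem_filter, Finset.mem_univ, true_and, Finset.mem_insert,
        Finset.mem_singleton, Fin.ext_iff]
      omega
  · refine ⟨block ⟨u / 3, by omega⟩, ⟨Finset.mem_image_of_mem _ (Finset.mem_univ _), ?_⟩, ?_⟩
    · simp [block]
    · rintro t ⟨ht, hu⟩
      obtain ⟨i, -, rfl⟩ := Finset.mem_image.1 ht
      congr 1
      exact Fin.ext (Finset.mem_filter.1 hu).2.symm

lemma stabPSA_add_insPSA {n : ℕ} (P : PSAPref n) (M : Finset (Finset (Fin (3 * n)))) :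
    stabPSA P M + insPSA P M = (3 * n).choose 3 := by
  have h : (Finset.univ.filter fun t : Finset (Fin (3 * n)) => t.card = 3).card =
      (3 * n).choose 3 := by
    rw [Finset.univ_filter_card_eq, Finset.card_powersetCard, Finset.card_univ, Fintype.card_fin]
  have hins : insPSA P M = (Finset.univ.filter fun t : Finset (Fin (3 * n)) =>
      t.card = 3 ∧ UnstablePSA P M t).card := by
    unfold insPSA
    congr 1
    exact Finset.filter_congr fun t _ => ⟨fun ht => ⟨ht.1, ht⟩, fun ht => ht.2⟩
  rw [hins, stabPSA, ← Finset.filter_filter, ← Finset.filter_filter, ← h, add_comm]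
  exact Finset.card_filter_add_card_filter_not _

lemma six_mul_choose_three (m : ℕ) :
    6 * (m.choose 3 : ℝ) = m * (m - 1) * (m - 2) := by
  have h := Nat.cast_choose_eq_descPochhammer_div ℝ m 3
  rw [h]
  simp [descPochhammer_succ_right, Nat.factorial]
  ring

/-- there is an absolute constant `C > 0` such that every 3PSA
instance of size `n` admits a matching `M` with `stab(M) ≥ 2n³ − C·n²`
(asymptotically a 4/9-factor approximation, since the total number of triples
is `(9/2)n³ − O(n²)`). -/
theorem asa_approximation :
    ∃ C : ℝ, 0 < C ∧ ∀ (n : ℕ) (P : PSAPref n),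
      ∃ M : Finset (Finset (Fin (3 * n))), IsMatching M ∧
        2 * (n : ℝ) ^ 3 - C * (n : ℝ) ^ 2 ≤ (stabPSA P M : ℝ) := by
  refine ⟨3, by norm_num, fun n P => ?_⟩
  obtain ⟨M, hM, hle⟩ := exists_triplePartition_two_mul_card_le
    (fun u t => P.rank u (t.erase u)) (exists_isTriplePartition_fin n)
  refine ⟨M, hM, ?_⟩
  have hins : 2 * insPSA P M ≤ (3 * n).choose 3 := by
    rw [Finset.univ_filter_card_eq, Finset.card_powersetCard, Finset.card_univ,
      Fintype.card_fin] at hle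
    convert hle using 2
    unfold insPSA UnstablePSA
    congr!
  have hstab : ((3 * n).choose 3 : ℝ) ≤ 2 * stabPSA P M := by
    have := stabPSA_add_insPSA P M
    exact_mod_cast (by omega : (3 * n).choose 3 ≤ 2 * stabPSA P M)
  have hchoose := six_mul_choose_three (3 * n)
  push_cast at hchoose
  have hn : (0 : ℝ) ≤ n := Nat.cast_nonneg n
  nlinarith [pow_nonneg hn 2, pow_nonneg hn 3]
end
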